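/- Let k = ℝ or k = ℂ and S = k[x_1,…,x_n]; let X^1,…,X^{p+m} be pairwise commuting k-linear derivations of S, g ∈ S, f_1,…,f_p ∈ S, and let {a_1,…,a_m} := g · det( (X^ν(f_μ))_{μ,ν=1,…,p+m} ) with f_{p+1} := a_1,…, f_{p+m} := a_m be the associated determinantal bracket. Then each generator f_μ (1 ≤ μ ≤ p) is a Casimir, i.e. {a_1,…,a_{m-1}, f_μ} = 0 for all a_1,…,a_{m-1} ∈ S; consequently the ideal I = (f_1,…,f_p) is a Nambu-Poisson ideal of S and the determinantal bracket induces a Nambu-Poisson bracket of arity m on the quotient A = S/I. -/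

import Mathlib

/-- Append an element `x` at the end of an `(m-1)`-tuple, producing an `m`-tuple. -/
def snocFun {α : Type*} (m : ℕ) (f : Fin (m - 1) → α) (x : α) : Fin m → α :=
  fun i => if h : (i : ℕ) < m - 1 then f ⟨i, h⟩ else x

/-- A Nambu-Poisson bracket of arity `m` on a commutative `k`-algebra `A`. -/
structure IsNambuPoisson (k : Type*) {A : Type*} [CommRing k] [CommRing A] [Algebra k A]
    (m : ℕ) (br : (Fin m → A) → A) : Prop where
  multilinear : ∀ (v : Fin m → A) (i : Fin m),
    IsLinearMap k (fun x : A => br (Function.update v i x))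
  antisymm : ∀ (v : Fin m → A) (σ : Equiv.Perm (Fin m)),
    br (fun i => v (σ i)) = (Equiv.Perm.sign σ : ℤ) • br v
  leibniz : ∀ (g : Fin (m - 1) → A) (a b : A),
    br (snocFun m g (a * b)) = a * br (snocFun m g b) + b * br (snocFun m g a)
  fundamental : ∀ (g : Fin (m - 1) → A) (h : Fin m → A),
    br (snocFun m g (br h)) =
      ∑ l : Fin m, br (Function.update h l (br (snocFun m g (h l))))

/-- The determinantal bracket `{a₁,…,a_m} := g · det(Xᵛ(f_μ))` where the last `m`
of the `f`'s are the arguments `a₁,…,a_m`. -/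
noncomputable def detBracket (k : Type*) [CommRing k] (n m p : ℕ)
    (X : Fin (p + m) → Derivation k (MvPolynomial (Fin n) k) (MvPolynomial (Fin n) k))
    (g : MvPolynomial (Fin n) k) (f : Fin p → MvPolynomial (Fin n) k) :
    (Fin m → MvPolynomial (Fin n) k) → MvPolynomial (Fin n) k :=
  fun a =>
    g * Matrix.det (Matrix.of fun μ ν : Fin (p + m) => X ν (Fin.append f a μ))

section Jacobian

open Matrix

variable {k R ι : Type*} [CommRing k] [CommRing R] [Algebra k R]

theorem Derivation.map_finset_prod [DecidableEq ι] (D : Derivation k R R) (s : Finset ι)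
    (f : ι → R) : D (∏ i ∈ s, f i) = ∑ i ∈ s, (∏ j ∈ s.erase i, f j) * D (f i) := by
  induction s using Finset.induction_on with
  | empty => simp
  | insert a s ha ih =>
    rw [Finset.prod_insert ha, D.leibniz, ih, Finset.sum_insert ha, Finset.erase_insert ha,
      smul_eq_mul, smul_eq_mul, Finset.mul_sum, add_comm]
    congr 1
    refine Finset.sum_congr rfl fun i hi => ?_
    have hia : a ≠ i := fun h => ha (h ▸ hi)
    rw [Finset.erase_insert_of_ne hia, Finset.prod_insert (by simp [ha]), mul_assoc]

/-- The Jacobian matrix of a tuple `v` with respect to a family of derivations `X`. -/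
def jacobianMatrix (X : ι → Derivation k R R) (v : ι → R) : Matrix ι ι R :=
  Matrix.of fun μ ν => X ν (v μ)

theorem jacobianMatrix_update [DecidableEq ι] (X : ι → Derivation k R R) (v : ι → R) (i : ι) (x : R) :
    jacobianMatrix X (Function.update v i x) =
      (jacobianMatrix X v).updateRow i fun ν => X ν x := by
  ext μ ν
  by_cases h : μ = i
  · subst h; simp [jacobianMatrix]
  · simp [jacobianMatrix, h]

variable [Fintype ι] [DecidableEq ι]

theorem Matrix.det_updateRow_eq_sum_adjugate (A : Matrix ι ι R) (j : ι) (w : ι → R) :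
    (A.updateRow j w).det = ∑ ν, A.adjugate ν j * w ν := by
  rw [← cramer_transpose_apply, cramer_eq_adjugate_mulVec, ← adjugate_transpose]
  rfl

theorem Derivation.map_det (D : Derivation k R R) (A : Matrix ι ι R) :
    D A.det = ∑ i, (A.updateRow i fun ν => D (A i ν)).det := by
  have key (i : ι) : (A.updateRow i fun ν => D (A i ν)).det =
      ∑ σ : Equiv.Perm ι, Equiv.Perm.sign σ •
        ((∏ j ∈ Finset.univ.erase i, A j (σ j)) * D (A i (σ i))) := by
    rw [← det_transpose, det_apply]
    refine Finset.sum_congr rfl fun σ _ => ?_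
    rw [← Finset.prod_erase_mul _ _ (Finset.mem_univ i)]
    congr 2
    · refine Finset.prod_congr rfl fun j hj => ?_
      simp [updateRow_ne (Finset.ne_of_mem_erase hj)]
    · simp
  rw [← det_transpose, det_apply, map_sum]
  simp_rw [key]
  rw [Finset.sum_comm]
  refine Finset.sum_congr rfl fun σ _ => ?_
  simp_rw [Units.smul_def]
  rw [map_zsmul, ← Finset.smul_sum]
  simp [D.map_finset_prod]

variable (X : ι → Derivation k R R)

/-- Piola's identity: the columns of the cofactor matrix of a Jacobian matrix are
divergence free. -/
theorem sum_derivation_adjugate_jacobianMatrix (hX : ∀ i j x, X i (X j x) = X j (X i x))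
    (v : ι → R) (j : ι) : ∑ ν, X ν ((jacobianMatrix X v).adjugate ν j) = 0 := by
  set A := jacobianMatrix X v with hA
  simp_rw [adjugate_apply, Derivation.map_det]
  rw [Finset.sum_comm]
  refine Finset.sum_eq_zero fun i _ => ?_
  by_cases hij : i = j
  · subst hij
    refine Finset.sum_eq_zero fun ν _ => det_eq_zero_of_row_eq_zero i fun l => ?_
    by_cases h : l = ν
    · subst h; simp
    · simp [h]
  · have h1 (ν : ι) : ((A.updateRow j (Pi.single ν 1)).updateRow i
        fun l => X ν (A.updateRow j (Pi.single ν 1) i l)).det =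
        ∑ l, ((A.updateRow j (Pi.single ν 1)).updateRow i (Pi.single l 1)).det *
          X ν (X l (v i)) := by
      rw [det_updateRow_eq_sum_adjugate]
      simp [adjugate_apply, updateRow_ne hij, hA, jacobianMatrix]
    simp_rw [h1]
    rw [← Finset.sum_product']
    have swap (ν l : ι) :
        ((A.updateRow j (Pi.single ν 1)).updateRow i (Pi.single l 1)).det =
          - ((A.updateRow j (Pi.single l 1)).updateRow i (Pi.single ν 1)).det := by
      have hperm := det_permute (Equiv.swap i j)
        ((A.updateRow j (Pi.single l 1)).updateRow i (Pi.single ν 1))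
      rw [Equiv.Perm.sign_swap hij, Units.val_neg, Units.val_one, Int.cast_neg, Int.cast_one,
        neg_one_mul] at hperm
      rw [← hperm]
      refine congrArg det ?_
      ext a b
      by_cases hai : a = i
      · subst hai; simp [updateRow_ne (Ne.symm hij)]
      · by_cases haj : a = j
        · subst haj; simp [hai]
        · simp [hai, haj, Equiv.swap_apply_of_ne_of_ne]
    refine Finset.sum_involution (fun q _ => q.swap) ?_ ?_ (by simp) (by simp)
    · rintro ⟨ν, l⟩ -
      simp [swap ν l, hX ν l]
    · rintro ⟨ν, l⟩ - hne heq
      obtain rfl : l = ν := congrArg Prod.fst heq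
      refine hne ?_
      simp only
      rw [det_zero_of_row_eq hij (by simp [updateRow_ne (Ne.symm hij)]), zero_mul]

/-- The derivation `∑ ν, g * adj(J) ν j • X ν`, obtained by fixing all arguments of the scaled
Jacobian determinant except the one in position `j`. -/
def jacobianDerivation (g : R) (v : ι → R) (j : ι) : Derivation k R R :=
  ∑ ν, (g * (jacobianMatrix X v).adjugate ν j) • X ν

theorem jacobianDerivation_apply (g : R) (v : ι → R) (j : ι) (x : R) :
    jacobianDerivation X g v j x =
      ∑ ν, g * (jacobianMatrix X v).adjugate ν j * X ν x := by
  change Derivation.coeFnAddMonoidHom _ x = _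
  simp [jacobianDerivation]

theorem mul_det_jacobianMatrix_update (g : R) (v : ι → R) (j : ι) (x : R) :
    g * (jacobianMatrix X (Function.update v j x)).det = jacobianDerivation X g v j x := by
  rw [jacobianMatrix_update, det_updateRow_eq_sum_adjugate, jacobianDerivation_apply,
    Finset.mul_sum]
  simp_rw [mul_assoc]

theorem sum_det_updateRow_mul (B C : Matrix ι ι R) :
    ∑ l, (B.updateRow l ((B * C) l)).det = C.trace * B.det := by
  simp_rw [det_updateRow_eq_sum_adjugate]
  calc ∑ l, ∑ ν, B.adjugate ν l * (B * C) l ν = (B.adjugate * (B * C)).trace := by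
        rw [Finset.sum_comm]; rfl
    _ = C.trace * B.det := by
        rw [← Matrix.mul_assoc, adjugate_mul, smul_mul, Matrix.one_mul, trace_smul, smul_eq_mul,
          mul_comm]

/-- The fundamental identity for the scaled Jacobian determinant of commuting derivations. -/
theorem jacobianDerivation_mul_det (hX : ∀ i j x, X i (X j x) = X j (X i x)) (g : R)
    (a b : ι → R) (j : ι) :
    jacobianDerivation X g a j (g * (jacobianMatrix X b).det) =
      ∑ l, g * (jacobianMatrix X
        (Function.update b l (jacobianDerivation X g a j (b l)))).det := by
  set H := jacobianDerivation X g a j with hH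
  set B := jacobianMatrix X b with hB
  set c : ι → R := fun ν => g * (jacobianMatrix X a).adjugate ν j with hc
  have hHx (x : R) : H x = ∑ ν, c ν * X ν x := jacobianDerivation_apply X g a j x
  let C : Matrix ι ι R := Matrix.of fun ν l => X l (c ν)
  have hrow (l : ι) : (fun ν => X ν (H (b l))) = (fun ν => H (B l ν)) + (B * C) l := by
    ext ν
    simp only [hHx, map_sum, Derivation.leibniz, smul_eq_mul, Pi.add_apply, Matrix.mul_apply, hB,
      jacobianMatrix, Matrix.of_apply, C, Finset.sum_add_distrib, hX ν]
  have hdiv : g * C.trace = H g := by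
    have := sum_derivation_adjugate_jacobianMatrix X hX a j
    simp only [Matrix.trace, Matrix.diag, C, Matrix.of_apply, hc, Derivation.leibniz, smul_eq_mul,
      Finset.sum_add_distrib, hHx, ← Finset.mul_sum, this]
    rw [mul_zero, zero_add, Finset.mul_sum]
    exact Finset.sum_congr rfl fun ν _ => by ring
  simp_rw [jacobianMatrix_update, ← hB, hrow, det_updateRow_add]
  rw [← Finset.mul_sum, Finset.sum_add_distrib, sum_det_updateRow_mul, ← H.map_det, mul_add,
    ← mul_assoc, hdiv, H.leibniz, smul_eq_mul, smul_eq_mul, mul_comm B.det]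

end Jacobian

section SnocFun

variable {α : Type*}

theorem snocFun_eq_update {m : ℕ} (hm : m - 1 < m) (a : Fin (m - 1) → α) (x y : α) :
    snocFun m a x = Function.update (snocFun m a y) ⟨m - 1, hm⟩ x := by
  ext i
  rw [Function.update_apply]
  have := i.2
  by_cases h : (i : ℕ) < m - 1
  · simp [snocFun, h, Fin.ext_iff, h.ne]
  · have : (i : ℕ) = m - 1 := by omega
    simp [snocFun, Fin.ext_iff, this]

theorem comp_snocFun {β : Type*} (π : α → β) (m : ℕ) (a : Fin (m - 1) → α) (x : α) :
    π ∘ snocFun m a x = snocFun m (π ∘ a) (π x) := by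
  ext i
  simp only [Function.comp_apply, snocFun]
  split <;> rfl

theorem Fin.append_update_natAdd {m p : ℕ} (f : Fin p → α) (v : Fin m → α) (i : Fin m) (x : α) :
    Fin.append f (Function.update v i x) =
      Function.update (Fin.append f v) (Fin.natAdd p i) x := by
  ext μ
  refine Fin.addCases (fun μ => ?_) (fun μ => ?_) μ
  · rw [Function.update_of_ne, Fin.append_left, Fin.append_left]
    simp only [ne_eq, Fin.ext_iff, Fin.val_castAdd, Fin.val_natAdd]
    omega
  · by_cases h : μ = i
    · subst h; simp
    · have : Fin.natAdd p μ ≠ Fin.natAdd p i := by simpa [Fin.ext_iff] using h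
      simp [h, this]

end SnocFun

/-- A bracket induced along a surjective algebra homomorphism by a Nambu-Poisson bracket is
Nambu-Poisson. -/
theorem IsNambuPoisson.of_surjective {k A B : Type*} [CommRing k] [CommRing A] [CommRing B]
    [Algebra k A] [Algebra k B] {m : ℕ} {br : (Fin m → A) → A} (h : IsNambuPoisson k m br)
    (π : A →ₐ[k] B) (hπ : Function.Surjective π) {brB : (Fin m → B) → B}
    (hbr : ∀ w : Fin m → A, brB (π ∘ w) = π (br w)) : IsNambuPoisson k m brB where
  multilinear v i := by
    obtain ⟨v, rfl⟩ := hπ.comp_left v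
    have hx (x : A) : brB (Function.update (π ∘ v) i (π x)) = π (br (Function.update v i x)) := by
      rw [← Function.comp_update, hbr]
    constructor
    · intro x y
      obtain ⟨x, rfl⟩ := hπ x
      obtain ⟨y, rfl⟩ := hπ y
      simp only [← map_add, hx, (h.multilinear v i).map_add]
    · intro c x
      obtain ⟨x, rfl⟩ := hπ x
      simp only [← map_smul, hx, (h.multilinear v i).map_smul]
  antisymm v σ := by
    obtain ⟨v, rfl⟩ := hπ.comp_left v
    rw [hbr, ← map_zsmul, ← h.antisymm, ← hbr]
    rfl
  leibniz g a b := by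
    obtain ⟨g, rfl⟩ := hπ.comp_left g
    obtain ⟨a, rfl⟩ := hπ a
    obtain ⟨b, rfl⟩ := hπ b
    simp only [← map_mul, ← comp_snocFun, hbr, h.leibniz, map_add]
  fundamental g v := by
    obtain ⟨g, rfl⟩ := hπ.comp_left g
    obtain ⟨v, rfl⟩ := hπ.comp_left v
    simp only [hbr, Function.comp_apply, ← comp_snocFun, h.fundamental, map_sum,
      ← Function.comp_update]

section DetBracket

open Matrix

variable {k : Type*} [CommRing k] {n m p : ℕ}
  (X : Fin (p + m) → Derivation k (MvPolynomial (Fin n) k) (MvPolynomial (Fin n) k))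
  (g : MvPolynomial (Fin n) k) (f : Fin p → MvPolynomial (Fin n) k)

theorem detBracket_eq (a : Fin m → MvPolynomial (Fin n) k) :
    detBracket k n m p X g f a = g * (jacobianMatrix X (Fin.append f a)).det := rfl

theorem detBracket_update (a : Fin m → MvPolynomial (Fin n) k) (i : Fin m)
    (x : MvPolynomial (Fin n) k) :
    detBracket k n m p X g f (Function.update a i x) =
      jacobianDerivation X g (Fin.append f a) (Fin.natAdd p i) x := by
  rw [detBracket_eq, Fin.append_update_natAdd, mul_det_jacobianMatrix_update]

theorem detBracket_snocFun (hm : m - 1 < m) (a : Fin (m - 1) → MvPolynomial (Fin n) k)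
    (x : MvPolynomial (Fin n) k) :
    detBracket k n m p X g f (snocFun m a x) =
      jacobianDerivation X g (Fin.append f (snocFun m a 0)) (Fin.natAdd p ⟨m - 1, hm⟩) x := by
  rw [snocFun_eq_update hm a x 0, detBracket_update]

theorem jacobianDerivation_append_casimir (a : Fin m → MvPolynomial (Fin n) k) (i : Fin m)
    (μ : Fin p) : jacobianDerivation X g (Fin.append f a) (Fin.natAdd p i) (f μ) = 0 := by
  have hne : Fin.castAdd m μ ≠ Fin.natAdd p i := by
    simp only [ne_eq, Fin.ext_iff, Fin.val_castAdd, Fin.val_natAdd]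
    omega
  rw [← mul_det_jacobianMatrix_update, det_zero_of_row_eq hne, mul_zero]
  ext ν
  simp [jacobianMatrix, hne]

theorem jacobianDerivation_append_mem (a : Fin m → MvPolynomial (Fin n) k) (i : Fin m)
    {x : MvPolynomial (Fin n) k} (hx : x ∈ Ideal.span (Set.range f)) :
    jacobianDerivation X g (Fin.append f a) (Fin.natAdd p i) x ∈ Ideal.span (Set.range f) := by
  induction hx using Submodule.span_induction with
  | mem x hx =>
    obtain ⟨μ, rfl⟩ := hx
    rw [jacobianDerivation_append_casimir]
    exact zero_mem _
  | zero => simp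
  | add x y _ _ hx hy => rw [map_add]; exact add_mem hx hy
  | smul c x hxI hx =>
    rw [smul_eq_mul, Derivation.leibniz, smul_eq_mul, smul_eq_mul]
    exact add_mem (Ideal.mul_mem_left _ _ hx) (Ideal.mul_mem_right _ _ hxI)

theorem detBracket_sub_mem (v w : Fin m → MvPolynomial (Fin n) k)
    (hvw : ∀ i, v i - w i ∈ Ideal.span (Set.range f)) :
    detBracket k n m p X g f v - detBracket k n m p X g f w ∈ Ideal.span (Set.range f) := by
  suffices ∀ s : Finset (Fin m), detBracket k n m p X g f (s.piecewise v w) -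
      detBracket k n m p X g f w ∈ Ideal.span (Set.range f) by
    simpa using this Finset.univ
  intro s
  induction s using Finset.induction_on with
  | empty => simp
  | insert i s hi ih =>
    refine (Ideal.span (Set.range f)).sub_mem_iff_left ih |>.mp ?_
    have hw : s.piecewise v w = Function.update (s.piecewise v w) i (w i) := by simp [hi]
    rw [sub_sub_sub_cancel_right, Finset.piecewise_insert, hw, Function.update_idem,
      detBracket_update, detBracket_update, ← map_sub]
    exact jacobianDerivation_append_mem X g f _ i (hvw i)

theorem detBracket_comp_perm (v : Fin m → MvPolynomial (Fin n) k) (σ : Equiv.Perm (Fin m)) :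
    detBracket k n m p X g f (v ∘ σ) =
      (Equiv.Perm.sign σ : ℤ) • detBracket k n m p X g f v := by
  let τ : Equiv.Perm (Fin (p + m)) := finSumFinEquiv.permCongr (Equiv.Perm.sumCongr 1 σ)
  have hτ : Equiv.Perm.sign τ = Equiv.Perm.sign σ := by simp [τ]
  have hmat : jacobianMatrix X (Fin.append f (v ∘ σ)) =
      (jacobianMatrix X (Fin.append f v)).submatrix τ id := by
    ext μ ν
    refine congrArg (fun x => MvPolynomial.coeff _ (X ν x)) ?_
    refine Fin.addCases (fun μ => ?_) (fun μ => ?_) μ <;> simp [τ]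
  rw [detBracket_eq, hmat, det_permute, hτ, detBracket_eq, zsmul_eq_mul]
  ring

theorem isNambuPoisson_detBracket (hm : m - 1 < m) (hX : ∀ i j x, X i (X j x) = X j (X i x)) :
    IsNambuPoisson k m (detBracket k n m p X g f) where
  multilinear v i := by
    simp_rw [detBracket_update]
    exact LinearMap.isLinear (jacobianDerivation X g _ _).toLinearMap
  antisymm := detBracket_comp_perm X g f
  leibniz a b c := by
    simp_rw [detBracket_snocFun X g f hm, Derivation.leibniz, smul_eq_mul]
  fundamental a b := by
    simp_rw [detBracket_snocFun X g f hm]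
    rw [detBracket_eq X g f b, jacobianDerivation_mul_det X hX, Fin.sum_univ_add]
    simp only [mul_det_jacobianMatrix_update, Fin.append_left, Fin.append_right,
      jacobianDerivation_append_casimir, map_zero, Finset.sum_const_zero, zero_add,
      detBracket_update]

end DetBracket

/-- each generator `f_μ` is a Casimir of the determinantal bracket;
consequently the ideal `I = (f₁,…,f_p)` is a Nambu-Poisson ideal and the
determinantal bracket induces a Nambu-Poisson bracket of arity `m` on `S ⧸ I`. -/
theorem detBracket_casimir_and_quotient
    (k : Type*) [RCLike k] (n m p : ℕ) (hm : 2 ≤ m)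
    (X : Fin (p + m) → Derivation k (MvPolynomial (Fin n) k) (MvPolynomial (Fin n) k))
    (hcomm : ∀ (i j : Fin (p + m)) (f : MvPolynomial (Fin n) k),
      X i (X j f) = X j (X i f))
    (g : MvPolynomial (Fin n) k) (f : Fin p → MvPolynomial (Fin n) k) :
    (∀ (a : Fin (m - 1) → MvPolynomial (Fin n) k) (μ : Fin p),
      detBracket k n m p X g f (snocFun m a (f μ)) = 0) ∧
    (∀ (a : Fin (m - 1) → MvPolynomial (Fin n) k),
      ∀ h ∈ Ideal.span (Set.range f),
        detBracket k n m p X g f (snocFun m a h) ∈ Ideal.span (Set.range f)) ∧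
    (∃ brQ : (Fin m → MvPolynomial (Fin n) k ⧸ Ideal.span (Set.range f)) →
        MvPolynomial (Fin n) k ⧸ Ideal.span (Set.range f),
      (∀ w : Fin m → MvPolynomial (Fin n) k,
        brQ (fun i => Ideal.Quotient.mk (Ideal.span (Set.range f)) (w i)) =
          Ideal.Quotient.mk (Ideal.span (Set.range f)) (detBracket k n m p X g f w)) ∧
      IsNambuPoisson k m brQ) := by
  have hlt : m - 1 < m := by omega
  have hlift (w : Fin m → MvPolynomial (Fin n) k) :
      Ideal.Quotient.mk (Ideal.span (Set.range f)) (detBracket k n m p X g f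
        fun i => (Ideal.Quotient.mk (Ideal.span (Set.range f)) (w i)).out) =
      Ideal.Quotient.mk (Ideal.span (Set.range f)) (detBracket k n m p X g f w) :=
    Ideal.Quotient.eq.mpr <| detBracket_sub_mem X g f _ _ fun i =>
      Ideal.Quotient.eq.mp (Ideal.Quotient.mk_out _)
  refine ⟨fun a μ => ?_, fun a h hh => ?_, fun v => Ideal.Quotient.mk _ (detBracket k n m p X g f
    fun i => (v i).out), hlift, ?_⟩
  · rw [detBracket_snocFun X g f hlt, jacobianDerivation_append_casimir]
  · rw [detBracket_snocFun X g f hlt]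
    exact jacobianDerivation_append_mem X g f _ _ hh
  · exact (isNambuPoisson_detBracket X g f hlt hcomm).of_surjective
      (Ideal.Quotient.mkₐ k (Ideal.span (Set.range f))) (Ideal.Quotient.mkₐ_surjective k _) hlift
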